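/- Fix y > 0. Then each of the four third-order partial derivatives ∂_{xxx} Put_BS(x,y), ∂_{xxy} Put_BS(x,y), ∂_{xyy} Put_BS(x,y), ∂_{yyy} Put_BS(x,y) tends to 0 as x → 0⁺ and also as x → ∞. -/

import Mathlib

open Real MeasureTheory Filter

/-- The standard normal cumulative distribution function Φ. -/
noncomputable def stdNormalCDF (x : ℝ) : ℝ :=
  ∫ t in Set.Iic x, (Real.sqrt (2 * Real.pi))⁻¹ * Real.exp (-t ^ 2 / 2)

/-- The standard normal density φ(z) = (2π)^{−1/2} e^{−z²/2}. -/
noncomputable def stdNormalPDF (z : ℝ) : ℝ :=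
  (Real.sqrt (2 * Real.pi))⁻¹ * Real.exp (-z ^ 2 / 2)

/-- d₊(x,y) = (ln(x/K) + R_d − R_f)/√y + √y/2. -/
noncomputable def dplus (K Rd Rf x y : ℝ) : ℝ :=
  (Real.log (x / K) + Rd - Rf) / Real.sqrt y + Real.sqrt y / 2

/-- d₋(x,y) = (ln(x/K) + R_d − R_f)/√y − √y/2. -/
noncomputable def dminus (K Rd Rf x y : ℝ) : ℝ :=
  (Real.log (x / K) + Rd - Rf) / Real.sqrt y - Real.sqrt y / 2

/-- The Black–Scholes put value Put_BS(x,y). -/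
noncomputable def PutBS (K Rd Rf x y : ℝ) : ℝ :=
  K * Real.exp (-Rd) * stdNormalCDF (-(dminus K Rd Rf x y))
    - x * Real.exp (-Rf) * stdNormalCDF (-(dplus K Rd Rf x y))

/-- ∂₃Put_BS/∂x³. -/
noncomputable def Pxxx (K Rd Rf x y : ℝ) : ℝ :=
  iteratedDeriv 3 (fun x' => PutBS K Rd Rf x' y) x

/-- ∂₃Put_BS/∂x²∂y. -/
noncomputable def Pxxy (K Rd Rf x y : ℝ) : ℝ :=
  deriv (fun y' => iteratedDeriv 2 (fun x' => PutBS K Rd Rf x' y') x) y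

/-- ∂₃Put_BS/∂x∂y². -/
noncomputable def Pxyy (K Rd Rf x y : ℝ) : ℝ :=
  deriv (fun x' => iteratedDeriv 2 (fun y' => PutBS K Rd Rf x' y') y) x

/-- ∂₃Put_BS/∂y³. -/
noncomputable def Pyyy (K Rd Rf x y : ℝ) : ℝ :=
  iteratedDeriv 3 (fun y' => PutBS K Rd Rf x y') y

open Polynomial in
/-- A Gaussian factor beats every polynomial. -/
lemma tendsto_eval_mul_exp_neg_quadratic_cocompact {a : ℝ} (ha : a < 0) (b : ℝ) (p : ℝ[X]) :
    Tendsto (fun t : ℝ => p.eval t * exp (a * t ^ 2 + b * t)) (cocompact ℝ) (nhds 0) := by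
  induction p using Polynomial.induction_on' with
  | add p q hp hq => simpa [add_mul] using hp.add hq
  | monomial n c =>
    have h := (cexp_neg_quadratic_isLittleO_abs_rpow_cocompact (a := (a : ℂ)) (by simpa using ha)
      (b : ℂ) (-(n : ℝ))).norm_left
    have hpow : (fun t : ℝ => c * t ^ n) =O[cocompact ℝ] fun t => |t| ^ (n : ℝ) := by
      refine Asymptotics.IsBigO.of_bound |c| (Eventually.of_forall fun t => ?_)
      simp
    have h1 := hpow.mul_isLittleO h
    have hne : ∀ᶠ t : ℝ in cocompact ℝ, t ≠ 0 := by
      have := (isCompact_singleton (x := (0 : ℝ))).compl_mem_cocompact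
      filter_upwards [this] with t ht using ht
    have h2 : (fun t : ℝ => |t| ^ (n : ℝ) * |t| ^ (-(n : ℝ))) =ᶠ[cocompact ℝ] fun _ => (1 : ℝ) := by
      filter_upwards [hne] with t ht
      rw [← rpow_add (abs_pos.2 ht)]
      simp
    have h3 := (h1.trans_eventuallyEq h2).tendsto_div_nhds_zero
    refine h3.congr fun t => ?_
    rw [Complex.norm_exp]
    have : ((a : ℂ) * t ^ 2 + b * t).re = a * t ^ 2 + b * t := by
      norm_cast
    simp [this]

lemma stdNormalPDF_neg (z : ℝ) : stdNormalPDF (-z) = stdNormalPDF z := by simp [stdNormalPDF]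

lemma hasDerivAt_stdNormalCDF (z : ℝ) : HasDerivAt stdNormalCDF (stdNormalPDF z) z := by
  have hcont : Continuous stdNormalPDF := by
    unfold stdNormalPDF
    fun_prop
  have hint : Integrable stdNormalPDF := by
    have h := (integrable_exp_neg_mul_sq (b := 1 / 2) (by norm_num)).const_mul (√(2 * π))⁻¹
    refine h.congr (Eventually.of_forall fun t => ?_)
    simp only [stdNormalPDF]
    ring_nf
  have heq : stdNormalCDF = fun x => (∫ t in (0 : ℝ)..x, stdNormalPDF t) + stdNormalCDF 0 := by
    funext x
    rw [← intervalIntegral.integral_Iic_sub_Iic hint.integrableOn hint.integrableOn]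
    simp [stdNormalCDF, stdNormalPDF]
  rw [heq]
  exact (intervalIntegral.integral_hasDerivAt_right (hcont.intervalIntegrable _ _)
    hcont.stronglyMeasurable.stronglyMeasurableAtFilter hcont.continuousAt).add_const _

/-- The log-forward-moneyness `ln(x/K) + R_d − R_f`. -/
noncomputable def logMoneyness (K Rd Rf x : ℝ) : ℝ := log (x / K) + Rd - Rf

/-- The kernel `x e^{−R_f} φ(d₊) / √y`, of which `∂_y Put_BS` and `∂_{xx} Put_BS` are multiples. -/
noncomputable def putKernel (K Rd Rf x y : ℝ) : ℝ :=
  x * exp (-Rf) * stdNormalPDF (dplus K Rd Rf x y) / √y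

/-- The logarithmic derivative of `putKernel` in `y`, as a function of the log-moneyness `l`. -/
noncomputable def kernelLogDeriv (l y : ℝ) : ℝ := l ^ 2 / (2 * y ^ 2) - 1 / (2 * y) - 1 / 8

section

variable {K Rd Rf x y : ℝ}

lemma exp_logMoneyness (hK : 0 < K) (hx : 0 < x) :
    exp (logMoneyness K Rd Rf x) = x / K * exp (Rd - Rf) := by
  rw [logMoneyness, add_sub_assoc, exp_add, exp_log (div_pos hx hK)]

lemma hasDerivAt_logMoneyness (hK : 0 < K) (hx : 0 < x) :
    HasDerivAt (logMoneyness K Rd Rf) (1 / x) x := by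
  have h := (((hasDerivAt_id x).div_const K).log (div_pos hx hK).ne').add_const Rd |>.sub_const Rf
  convert! h using 1
  simp only [id]
  field_simp

lemma stdNormalPDF_dplus (hy : 0 < y) :
    stdNormalPDF (dplus K Rd Rf x y) = (√(2 * π))⁻¹ *
      exp (-logMoneyness K Rd Rf x ^ 2 / (2 * y) - logMoneyness K Rd Rf x / 2 - y / 8) := by
  have hs : √y ≠ 0 := (sqrt_pos.2 hy).ne'
  simp only [stdNormalPDF, dplus, logMoneyness]
  congr 2
  generalize log (x / K) + Rd - Rf = l
  nth_rewrite 3 4 [← sq_sqrt hy.le]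
  field_simp
  ring

lemma stdNormalPDF_dminus (hK : 0 < K) (hx : 0 < x) (hy : 0 < y) :
    K * exp (-Rd) * stdNormalPDF (dminus K Rd Rf x y) =
      x * exp (-Rf) * stdNormalPDF (dplus K Rd Rf x y) := by
  have hs : √y ≠ 0 := (sqrt_pos.2 hy).ne'
  have h : stdNormalPDF (dminus K Rd Rf x y) =
      stdNormalPDF (dplus K Rd Rf x y) * exp (logMoneyness K Rd Rf x) := by
    simp only [stdNormalPDF, mul_assoc, ← exp_add]
    congr 2
    simp only [dminus, dplus, logMoneyness]
    generalize log (x / K) + Rd - Rf = l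
    field_simp
    ring
  have he : exp (Rd - Rf) = exp (-Rf) * exp Rd := by rw [← exp_add]; ring_nf
  have hd : exp (-Rd) * exp Rd = 1 := by rw [← exp_add]; simp
  rw [h, exp_logMoneyness hK hx, he]
  have hxK : K * (x / K) = x := mul_div_cancel₀ x hK.ne'
  linear_combination x * stdNormalPDF (dplus K Rd Rf x y) * exp (-Rf) * hd +
    exp (-Rd) * exp Rd * exp (-Rf) * stdNormalPDF (dplus K Rd Rf x y) * hxK

lemma putKernel_eq (hy : 0 < y) :
    putKernel K Rd Rf x y = exp (-Rf) * (√(2 * π))⁻¹ / √y * x *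
      exp (-logMoneyness K Rd Rf x ^ 2 / (2 * y) - logMoneyness K Rd Rf x / 2 - y / 8) := by
  rw [putKernel, stdNormalPDF_dplus hy]
  ring

lemma hasDerivAt_putKernel_left (hK : 0 < K) (hx : 0 < x) (hy : 0 < y) :
    HasDerivAt (fun x' => putKernel K Rd Rf x' y)
      (putKernel K Rd Rf x y / x * (1 / 2 - logMoneyness K Rd Rf x / y)) x := by
  have hl := hasDerivAt_logMoneyness (Rd := Rd) (Rf := Rf) hK hx
  have h := (((hasDerivAt_id x).const_mul (exp (-Rf) * (√(2 * π))⁻¹ / √y)).mul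
    ((((hl.pow 2).neg.div_const (2 * y)).sub (hl.div_const 2)).sub_const (y / 8)).exp)
  simp_rw [putKernel_eq hy]
  convert! h using 1
  simp only [id, Pi.pow_apply, Pi.neg_apply, Pi.sub_apply]
  field_simp
  ring

lemma hasDerivAt_putKernel_right (hy : 0 < y) :
    HasDerivAt (fun y' => putKernel K Rd Rf x y')
      (putKernel K Rd Rf x y * kernelLogDeriv (logMoneyness K Rd Rf x) y) y := by
  have hs : √y ≠ 0 := (sqrt_pos.2 hy).ne'
  set l := logMoneyness K Rd Rf x with hl
  have hsqrt := ((hasDerivAt_sqrt hy.ne').inv hs).const_mul (exp (-Rf) * (√(2 * π))⁻¹ * x)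
  have hinv := (hasDerivAt_inv hy.ne').const_mul (-l ^ 2 / 2)
  have h := hsqrt.mul ((hinv.sub_const (l / 2)).sub ((hasDerivAt_id y).div_const 8)).exp
  have heq : (fun y' => putKernel K Rd Rf x y') =ᶠ[nhds y] fun y' =>
      exp (-Rf) * (√(2 * π))⁻¹ * x * (√y')⁻¹ * exp (-l ^ 2 / 2 * y'⁻¹ - l / 2 - y' / 8) := by
    filter_upwards [lt_mem_nhds hy] with y' hy'
    rw [putKernel_eq hy', ← hl]
    ring_nf
  refine HasDerivAt.congr_of_eventuallyEq ?_ heq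
  convert! h using 1
  rw [heq.eq_of_nhds]
  simp only [id, Pi.inv_apply, Pi.sub_apply, kernelLogDeriv]
  have hsq : √y ^ 2 = y := sq_sqrt hy.le
  field_simp
  rw [hsq]
  field_simp
  ring

lemma hasDerivAt_kernelLogDeriv_right (l : ℝ) (hy : 0 < y) :
    HasDerivAt (kernelLogDeriv l) (1 / (2 * y ^ 2) - l ^ 2 / y ^ 3) y := by
  have h1 := ((hasDerivAt_pow 2 y).inv (by positivity)).const_mul (l ^ 2 / 2)
  have h2 := (hasDerivAt_inv hy.ne').const_mul (1 / 2 : ℝ)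
  have h := (h1.sub h2).sub_const (1 / 8)
  convert! h using 1
  · funext z
    simp only [kernelLogDeriv, Pi.inv_apply, Pi.sub_apply]
    ring
  · field_simp
    ring

lemma hasDerivAt_PutBS_left (hK : 0 < K) (hx : 0 < x) (hy : 0 < y) :
    HasDerivAt (fun x' => PutBS K Rd Rf x' y)
      (-(exp (-Rf) * stdNormalCDF (-dplus K Rd Rf x y))) x := by
  have hl := (hasDerivAt_logMoneyness (Rd := Rd) (Rf := Rf) hK hx).div_const (√y)
  have hp : HasDerivAt (fun x' => dplus K Rd Rf x' y) (1 / x / √y) x := hl.add_const (√y / 2)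
  have hm : HasDerivAt (fun x' => dminus K Rd Rf x' y) (1 / x / √y) x := hl.sub_const (√y / 2)
  have h := (((hasDerivAt_stdNormalCDF _).comp x hm.neg).const_mul (K * exp (-Rd))).sub
    (((hasDerivAt_id x).mul_const (exp (-Rf))).mul ((hasDerivAt_stdNormalCDF _).comp x hp.neg))
  convert! h using 1
  have hpdf := stdNormalPDF_dminus (Rd := Rd) (Rf := Rf) hK hx hy
  simp only [id, Pi.neg_apply, Function.comp_apply, stdNormalPDF_neg]
  linear_combination (1 / x / √y) * hpdf

lemma hasDerivAt_PutBS_right (hK : 0 < K) (hx : 0 < x) (hy : 0 < y) :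
    HasDerivAt (fun y' => PutBS K Rd Rf x y') (putKernel K Rd Rf x y / 2) y := by
  have hs : √y ≠ 0 := (sqrt_pos.2 hy).ne'
  have hsq := hasDerivAt_sqrt hy.ne'
  have hd := (hsq.inv hs).const_mul (logMoneyness K Rd Rf x)
  have hp : HasDerivAt (fun y' => dplus K Rd Rf x y') _ y := hd.add (hsq.div_const 2)
  have hm : HasDerivAt (fun y' => dminus K Rd Rf x y') _ y := hd.sub (hsq.div_const 2)
  have h := (((hasDerivAt_stdNormalCDF _).comp y hm.neg).const_mul (K * exp (-Rd))).sub
    (((hasDerivAt_stdNormalCDF _).comp y hp.neg).const_mul (x * exp (-Rf)))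
  convert! h using 1
  have hpdf := stdNormalPDF_dminus (Rd := Rd) (Rf := Rf) hK hx hy
  simp only [Pi.neg_apply, stdNormalPDF_neg, putKernel, ← mul_assoc, hpdf]
  field_simp
  ring

lemma iteratedDeriv_two_PutBS_left (hK : 0 < K) (hx : 0 < x) (hy : 0 < y) :
    iteratedDeriv 2 (fun x' => PutBS K Rd Rf x' y) x = putKernel K Rd Rf x y / x ^ 2 := by
  have hd : deriv (fun x' => PutBS K Rd Rf x' y) =ᶠ[nhds x] fun x' =>
      -(exp (-Rf) * stdNormalCDF (-dplus K Rd Rf x' y)) := by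
    filter_upwards [lt_mem_nhds hx] with x' hx' using (hasDerivAt_PutBS_left hK hx' hy).deriv
  rw [iteratedDeriv_succ, iteratedDeriv_one, hd.deriv_eq]
  have hl := (hasDerivAt_logMoneyness (Rd := Rd) (Rf := Rf) hK hx).div_const (√y)
  have hp : HasDerivAt (fun x' => dplus K Rd Rf x' y) (1 / x / √y) x := hl.add_const (√y / 2)
  have h := (((hasDerivAt_stdNormalCDF _).comp x hp.neg).const_mul (exp (-Rf))).neg
  refine h.deriv.trans ?_
  simp only [Pi.neg_apply, stdNormalPDF_neg, putKernel]
  field_simp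

lemma iteratedDeriv_two_PutBS_right (hK : 0 < K) (hx : 0 < x) (hy : 0 < y) :
    iteratedDeriv 2 (fun y' => PutBS K Rd Rf x y') y =
      putKernel K Rd Rf x y * kernelLogDeriv (logMoneyness K Rd Rf x) y / 2 := by
  have hd : deriv (fun y' => PutBS K Rd Rf x y') =ᶠ[nhds y] fun y' =>
      putKernel K Rd Rf x y' / 2 := by
    filter_upwards [lt_mem_nhds hy] with y' hy' using (hasDerivAt_PutBS_right hK hx hy').deriv
  rw [iteratedDeriv_succ, iteratedDeriv_one, hd.deriv_eq]
  exact ((hasDerivAt_putKernel_right hy).div_const 2).deriv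

lemma Pxxx_eq (hK : 0 < K) (hx : 0 < x) (hy : 0 < y) :
    Pxxx K Rd Rf x y =
      putKernel K Rd Rf x y / x ^ 3 * (-3 / 2 - logMoneyness K Rd Rf x / y) := by
  have hd : iteratedDeriv 2 (fun x' => PutBS K Rd Rf x' y) =ᶠ[nhds x] fun x' =>
      putKernel K Rd Rf x' y / x' ^ 2 := by
    filter_upwards [lt_mem_nhds hx] with x' hx' using iteratedDeriv_two_PutBS_left hK hx' hy
  rw [Pxxx, iteratedDeriv_succ, hd.deriv_eq]
  refine ((hasDerivAt_putKernel_left hK hx hy).div (hasDerivAt_pow 2 x)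
    (by positivity)).deriv.trans ?_
  field_simp
  ring

lemma Pxxy_eq (hK : 0 < K) (hx : 0 < x) (hy : 0 < y) :
    Pxxy K Rd Rf x y =
      putKernel K Rd Rf x y / x ^ 2 * kernelLogDeriv (logMoneyness K Rd Rf x) y := by
  have hd : (fun y' => iteratedDeriv 2 (fun x' => PutBS K Rd Rf x' y') x) =ᶠ[nhds y] fun y' =>
      putKernel K Rd Rf x y' / x ^ 2 := by
    filter_upwards [lt_mem_nhds hy] with y' hy' using iteratedDeriv_two_PutBS_left hK hx hy'
  rw [Pxxy, hd.deriv_eq, ((hasDerivAt_putKernel_right hy).div_const (x ^ 2)).deriv]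
  ring

lemma Pxyy_eq (hK : 0 < K) (hx : 0 < x) (hy : 0 < y) :
    Pxyy K Rd Rf x y = putKernel K Rd Rf x y / x ^ 1 *
      (((1 / 2 - logMoneyness K Rd Rf x / y) * kernelLogDeriv (logMoneyness K Rd Rf x) y +
        logMoneyness K Rd Rf x / y ^ 2) / 2) := by
  have hd : (fun x' => iteratedDeriv 2 (fun y' => PutBS K Rd Rf x' y') y) =ᶠ[nhds x] fun x' =>
      putKernel K Rd Rf x' y * kernelLogDeriv (logMoneyness K Rd Rf x') y / 2 := by
    filter_upwards [lt_mem_nhds hx] with x' hx' using iteratedDeriv_two_PutBS_right hK hx' hy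
  have hl := hasDerivAt_logMoneyness (Rd := Rd) (Rf := Rf) hK hx
  have hk : HasDerivAt (fun x' => kernelLogDeriv (logMoneyness K Rd Rf x') y) _ x :=
    (((hl.pow 2).div_const (2 * y ^ 2)).sub_const (1 / (2 * y))).sub_const (1 / 8)
  rw [Pxyy, hd.deriv_eq]
  refine (((hasDerivAt_putKernel_left hK hx hy).mul hk).div_const 2).deriv.trans ?_
  field_simp
  ring

lemma Pyyy_eq (hK : 0 < K) (hx : 0 < x) (hy : 0 < y) :
    Pyyy K Rd Rf x y = putKernel K Rd Rf x y / x ^ 0 *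
      ((kernelLogDeriv (logMoneyness K Rd Rf x) y ^ 2 + 1 / (2 * y ^ 2) -
        logMoneyness K Rd Rf x ^ 2 / y ^ 3) / 2) := by
  have hd : iteratedDeriv 2 (fun y' => PutBS K Rd Rf x y') =ᶠ[nhds y] fun y' =>
      putKernel K Rd Rf x y' * kernelLogDeriv (logMoneyness K Rd Rf x) y' / 2 := by
    filter_upwards [lt_mem_nhds hy] with y' hy' using iteratedDeriv_two_PutBS_right hK hx hy'
  rw [Pyyy, iteratedDeriv_succ, hd.deriv_eq]
  refine (((hasDerivAt_putKernel_right hy).mul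
    (hasDerivAt_kernelLogDeriv_right _ hy)).div_const 2).deriv.trans ?_
  ring

lemma putKernel_div_pow (hK : 0 < K) (hx : 0 < x) (hy : 0 < y) (n : ℕ) :
    putKernel K Rd Rf x y / x ^ n =
      exp (-Rf) * (√(2 * π))⁻¹ / √y * exp (-y / 8) * (K * exp (Rf - Rd)) ^ (1 - n : ℝ) *
        exp (-(2 * y)⁻¹ * logMoneyness K Rd Rf x ^ 2 +
          (1 / 2 - n) * logMoneyness K Rd Rf x) := by
  have hxl : x = K * exp (Rf - Rd) * exp (logMoneyness K Rd Rf x) := by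
    rw [exp_logMoneyness hK hx, mul_assoc, mul_left_comm (exp _), ← exp_add]
    simp [hK.ne', mul_div_cancel₀]
  have hpow : x / x ^ n =
      (K * exp (Rf - Rd)) ^ (1 - n : ℝ) * exp ((1 - n) * logMoneyness K Rd Rf x) := by
    rw [← rpow_natCast, div_eq_mul_inv, ← rpow_neg hx.le]
    nth_rewrite 1 [← rpow_one x]
    rw [← rpow_add hx, ← sub_eq_add_neg]
    nth_rewrite 1 [hxl]
    rw [mul_rpow (by positivity) (exp_pos _).le, ← exp_mul, mul_comm (logMoneyness K Rd Rf x)]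
  have hexp : exp ((1 - n) * logMoneyness K Rd Rf x) *
      exp (-logMoneyness K Rd Rf x ^ 2 / (2 * y) - logMoneyness K Rd Rf x / 2 - y / 8) =
      exp (-y / 8) * exp (-(2 * y)⁻¹ * logMoneyness K Rd Rf x ^ 2 +
        (1 / 2 - n) * logMoneyness K Rd Rf x) := by
    rw [← exp_add, ← exp_add]
    ring_nf
  rw [putKernel_eq hy]
  linear_combination
    (exp (-Rf) * (√(2 * π))⁻¹ / √y *
      exp (-logMoneyness K Rd Rf x ^ 2 / (2 * y) - logMoneyness K Rd Rf x / 2 - y / 8)) * hpow +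
    (exp (-Rf) * (√(2 * π))⁻¹ / √y * (K * exp (Rf - Rd)) ^ (1 - n : ℝ)) * hexp

lemma tendsto_logMoneyness_nhdsGT_zero (hK : 0 < K) :
    Tendsto (logMoneyness K Rd Rf) (nhdsWithin 0 (Set.Ioi 0)) atBot := by
  have h : Tendsto (fun x => log x + (Rd - Rf - log K)) (nhdsWithin 0 (Set.Ioi 0)) atBot :=
    tendsto_atBot_add_const_right _ _ tendsto_log_nhdsGT_zero
  refine h.congr' ?_
  filter_upwards [self_mem_nhdsWithin] with x (hx : 0 < x)
  rw [logMoneyness, log_div hx.ne' hK.ne']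
  ring

lemma tendsto_logMoneyness_atTop (hK : 0 < K) : Tendsto (logMoneyness K Rd Rf) atTop atTop := by
  have h := tendsto_atTop_add_const_right _ (Rd - Rf) (tendsto_log_atTop.comp
    (tendsto_id.atTop_div_const hK))
  exact h.congr fun x => (add_sub_assoc _ _ _).symm

/-- A product of the kernel, a power of `x` and a polynomial in the log-moneyness vanishes as
`x → 0⁺` and as `x → ∞`. -/
lemma tendsto_zero_of_eq_putKernel_mul_eval (hK : 0 < K) (hy : 0 < y) (n : ℕ)
    (p : Polynomial ℝ) {f : ℝ → ℝ}
    (hf : ∀ x, 0 < x → f x = putKernel K Rd Rf x y / x ^ n * p.eval (logMoneyness K Rd Rf x)) :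
    Tendsto f (nhdsWithin 0 (Set.Ioi 0)) (nhds 0) ∧ Tendsto f atTop (nhds 0) := by
  have key {F : Filter ℝ} (hpos : ∀ᶠ x in F, 0 < x)
      (hF : Tendsto (logMoneyness K Rd Rf) F (cocompact ℝ)) : Tendsto f F (nhds 0) := by
    have h := ((tendsto_eval_mul_exp_neg_quadratic_cocompact (a := -(2 * y)⁻¹)
      (by simpa using hy) (1 / 2 - n) p).comp hF).const_mul
        (exp (-Rf) * (√(2 * π))⁻¹ / √y * exp (-y / 8) * (K * exp (Rf - Rd)) ^ (1 - n : ℝ))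
    rw [mul_zero] at h
    refine h.congr' ?_
    filter_upwards [hpos] with x hx
    rw [hf x hx, putKernel_div_pow hK hx hy, Function.comp_apply]
    ring
  exact ⟨key self_mem_nhdsWithin
      ((tendsto_logMoneyness_nhdsGT_zero hK).mono_right atBot_le_cocompact),
    key (eventually_gt_atTop 0) ((tendsto_logMoneyness_atTop hK).mono_right atTop_le_cocompact)⟩

end

/-- For fixed y > 0, each third-order partial derivative of Put_BS tends to 0 as x → 0⁺
and as x → ∞. -/
theorem putBS_third_partials_vanish_in_x (K Rd Rf : ℝ) (hK : 0 < K)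
    (y : ℝ) (hy : 0 < y) :
    Tendsto (fun x => Pxxx K Rd Rf x y) (nhdsWithin 0 (Set.Ioi 0)) (nhds 0) ∧
    Tendsto (fun x => Pxxx K Rd Rf x y) atTop (nhds 0) ∧
    Tendsto (fun x => Pxxy K Rd Rf x y) (nhdsWithin 0 (Set.Ioi 0)) (nhds 0) ∧
    Tendsto (fun x => Pxxy K Rd Rf x y) atTop (nhds 0) ∧
    Tendsto (fun x => Pxyy K Rd Rf x y) (nhdsWithin 0 (Set.Ioi 0)) (nhds 0) ∧
    Tendsto (fun x => Pxyy K Rd Rf x y) atTop (nhds 0) ∧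
    Tendsto (fun x => Pyyy K Rd Rf x y) (nhdsWithin 0 (Set.Ioi 0)) (nhds 0) ∧
    Tendsto (fun x => Pyyy K Rd Rf x y) atTop (nhds 0) := by
  let a : Polynomial ℝ := .C (1 / (2 * y ^ 2)) * .X ^ 2 - .C (1 / (2 * y) + 1 / 8)
  have ha (l : ℝ) : a.eval l = kernelLogDeriv l y := by
    simp only [a, kernelLogDeriv, Polynomial.eval_sub, Polynomial.eval_mul, Polynomial.eval_C,
      Polynomial.eval_pow, Polynomial.eval_X]
    ring
  obtain ⟨h1, h2⟩ := tendsto_zero_of_eq_putKernel_mul_eval (f := fun x => Pxxx K Rd Rf x y) hK hy 3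
    (.C (-3 / 2) - .C (1 / y) * .X) fun x hx => by
      rw [Pxxx_eq hK hx hy, Polynomial.eval_sub, Polynomial.eval_mul, Polynomial.eval_C,
        Polynomial.eval_C, Polynomial.eval_X]
      ring
  obtain ⟨h3, h4⟩ := tendsto_zero_of_eq_putKernel_mul_eval (f := fun x => Pxxy K Rd Rf x y) hK hy 2
    a fun x hx => by rw [Pxxy_eq hK hx hy, ha]
  obtain ⟨h5, h6⟩ := tendsto_zero_of_eq_putKernel_mul_eval (f := fun x => Pxyy K Rd Rf x y) hK hy 1
    (.C (1 / 2) * ((.C (1 / 2) - .C (1 / y) * .X) * a + .C (1 / y ^ 2) * .X)) fun x hx => by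
      simp only [Pxyy_eq hK hx hy, Polynomial.eval_add, Polynomial.eval_sub, Polynomial.eval_mul,
        Polynomial.eval_C, Polynomial.eval_X, ha]
      ring
  obtain ⟨h7, h8⟩ := tendsto_zero_of_eq_putKernel_mul_eval (f := fun x => Pyyy K Rd Rf x y) hK hy 0
    (.C (1 / 2) * (a ^ 2 + .C (1 / (2 * y ^ 2)) - .C (1 / y ^ 3) * .X ^ 2)) fun x hx => by
      simp only [Pyyy_eq hK hx hy, Polynomial.eval_add, Polynomial.eval_sub, Polynomial.eval_mul,
        Polynomial.eval_pow, Polynomial.eval_C, Polynomial.eval_X, ha]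
      ring
  exact ⟨h1, h2, h3, h4, h5, h6, h7, h8⟩
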